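/- Suppose each buyer has ρ_i ∈ [0,1]: buyers with ρ_i > 0 update by Proportional Response b_ij^{t+1} = e_i · a_ij (b_ij^t/p_j(b^t))^{ρ_i} / Σ_k a_ik (b_ik^t/p_k(b^t))^{ρ_i}, and buyers with ρ_i = 0 update to b_ij^{t+1} = e_i·a_ij (their equilibrium spending b*_ij = e_i a_ij), starting from an entrywise positive feasible b^0. Let b*_{>0} be the minimizer of Φ(·, b*_{=0}) over feasible spendings of the ρ_i > 0 buyers. Then for all T ≥ 1: Φ(b^T_{>0}, b*_{=0}) − Φ(b*_{>0}, b*_{=0}) ≤ (1/T)·( Σ_{i: ρ_i>0} (1/ρ_i)·KL(b_i* ‖ b_i^0) + Σ_{i: ρ_i=0} KL(b_i* ‖ b_i^0) ). -/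

import Mathlib

open Finset

/-- Price of good `j` given spending `b`. -/
noncomputable def price {m n : ℕ} (b : Fin m → Fin n → ℝ) (j : Fin n) : ℝ :=
  ∑ i, b i j

/-- KL divergence between two nonnegative vectors. -/
noncomputable def KL {n : ℕ} (x y : Fin n → ℝ) : ℝ :=
  ∑ j, x j * Real.log (x j / y j)

/-- Feasible spending: nonnegative entries, each buyer spends exactly her budget. -/
def Feasible {m n : ℕ} (e : Fin m → ℝ) (b : Fin m → Fin n → ℝ) : Prop :=
  ∀ i, (∀ j, 0 ≤ b i j) ∧ ∑ j, b i j = e i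

/-- `mix S b b'` takes buyer `i`'s spending from `b` when `i ∈ S`, else from `b'`. -/
def mix {m n : ℕ} (S : Finset (Fin m)) (b b' : Fin m → Fin n → ℝ) :
    Fin m → Fin n → ℝ :=
  fun i => if i ∈ S then b i else b' i

/-- The potential `Φ`, where `S` is the set of buyers with `ρ_i ≠ 0` and its
complement consists of the Cobb-Douglas buyers (`ρ_i = 0`), who contribute the
term `Σ_j b_ij log p_j(b)`. -/
noncomputable def PhiCD {m n : ℕ} (S : Finset (Fin m))
    (a : Fin m → Fin n → ℝ) (ρ : Fin m → ℝ) (b : Fin m → Fin n → ℝ) : ℝ :=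
  (-∑ i ∈ S,
      (1 / ρ i) * ∑ j, b i j * Real.log (a i j * b i j ^ (ρ i - 1) / price b j ^ ρ i)) +
    ∑ i ∈ Sᶜ, ∑ j, b i j * Real.log (price b j)

/-- The tangent-line bound `x log (x / y) ≥ x - y`. -/
theorem sub_le_mul_log_div {x y : ℝ} (hx : 0 ≤ x) (hy : 0 < y) :
    x - y ≤ x * Real.log (x / y) := by
  rcases hx.eq_or_lt with rfl | hx
  · simp [hy.le]
  · have h := Real.one_sub_inv_le_log_of_pos (div_pos hx hy)
    calc x - y = x * (1 - (x / y)⁻¹) := by field_simp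
      _ ≤ _ := mul_le_mul_of_nonneg_left h hx.le

/-- Gibbs' inequality. -/
theorem KL_nonneg {n : ℕ} {x y : Fin n → ℝ} (hx : ∀ j, 0 ≤ x j) (hy : ∀ j, 0 < y j)
    (h : ∑ j, x j = ∑ j, y j) : 0 ≤ KL x y := by
  calc (0 : ℝ) = ∑ j, (x j - y j) := by rw [sum_sub_distrib, h, sub_self]
    _ ≤ KL x y := sum_le_sum fun j _ => sub_le_mul_log_div (hx j) (hy j)

theorem KL_self {n : ℕ} (x : Fin n → ℝ) : KL x x = 0 := by
  refine sum_eq_zero fun j _ => ?_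
  by_cases h : x j = 0 <;> simp [h]

/-- The log-sum inequality. -/
theorem log_sum_inequality {ι : Type*} [Fintype ι] {x y : ι → ℝ}
    (hx : ∀ i, 0 ≤ x i) (hy : ∀ i, 0 < y i) :
    (∑ i, x i) * Real.log ((∑ i, x i) / ∑ i, y i) ≤ ∑ i, x i * Real.log (x i / y i) := by
  rcases (sum_nonneg fun i _ => hx i : 0 ≤ ∑ i, x i).eq_or_lt with h | hX
  · have h0 : ∀ i, x i = 0 := fun i =>
      (sum_eq_zero_iff_of_nonneg fun i _ => hx i).1 h.symm i (mem_univ i)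
    simp [h0]
  have hne : (univ : Finset ι).Nonempty := by
    by_contra h
    simp [not_nonempty_iff_eq_empty.1 h] at hX
  have hY : 0 < ∑ i, y i := sum_pos (fun i _ => hy i) hne
  set X := ∑ i, x i with hXdef
  set Y := ∑ i, y i with hYdef
  have key : ∀ i, x i - y i * (X / Y) ≤
      x i * Real.log (x i / y i) - x i * Real.log (X / Y) := by
    intro i
    have hc : 0 < X / Y := div_pos hX hY
    refine (sub_le_mul_log_div (hx i) (mul_pos (hy i) hc)).trans_eq ?_
    rcases (hx i).eq_or_lt with h | h
    · simp [← h]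
    · rw [← div_div, Real.log_div (div_pos h (hy i)).ne' hc.ne']
      ring
  have hsum := sum_le_sum fun i (_ : i ∈ univ) => key i
  rw [sum_sub_distrib, sum_sub_distrib, ← sum_mul, ← sum_mul, ← hXdef, ← hYdef,
    mul_div_cancel₀ _ hY.ne'] at hsum
  linarith

theorem price_pos {m n : ℕ} {b : Fin m → Fin n → ℝ} (hb : ∀ i j, 0 < b i j) (i : Fin m)
    (j : Fin n) : 0 < price b j :=
  sum_pos (fun i _ => hb i j) ⟨i, mem_univ i⟩

theorem price_nonneg {m n : ℕ} {b : Fin m → Fin n → ℝ} (hb : ∀ i j, 0 ≤ b i j)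
    (j : Fin n) : 0 ≤ price b j :=
  sum_nonneg fun i _ => hb i j

theorem le_price {m n : ℕ} {b : Fin m → Fin n → ℝ} (hb : ∀ i j, 0 ≤ b i j) (i : Fin m)
    (j : Fin n) : b i j ≤ price b j :=
  single_le_sum (f := fun i => b i j) (fun i _ => hb i j) (mem_univ i)

theorem sum_price {m n : ℕ} {e : Fin m → ℝ} {b : Fin m → Fin n → ℝ} (hb : Feasible e b) :
    ∑ j, price b j = ∑ i, e i := by
  unfold price
  rw [sum_comm]
  exact sum_congr rfl fun i _ => (hb i).2

/-- Aggregating the spending of the buyers into prices does not increase the divergence. -/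
theorem KL_price_le {m n : ℕ} {x y : Fin m → Fin n → ℝ} (hx : ∀ i j, 0 ≤ x i j)
    (hy : ∀ i j, 0 < y i j) : KL (price x) (price y) ≤ ∑ i, KL (x i) (y i) := by
  unfold KL
  rw [sum_comm]
  exact sum_le_sum fun j _ => log_sum_inequality (fun i => hx i j) (fun i => hy i j)

/-- The normalisation factor of the Proportional Response update of buyer `i`. -/
noncomputable def responseNorm {m n : ℕ} (a : Fin m → Fin n → ℝ) (ρ : Fin m → ℝ)
    (b : Fin m → Fin n → ℝ) (i : Fin m) : ℝ :=
  ∑ k, a i k * (b i k / price b k) ^ ρ i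

theorem responseNorm_pos {m n : ℕ} {a : Fin m → Fin n → ℝ} (ha : ∀ i j, 0 < a i j)
    (ρ : Fin m → ℝ) {b : Fin m → Fin n → ℝ} (hb : ∀ i j, 0 < b i j) (i : Fin m) (j : Fin n) :
    0 < responseNorm a ρ b i :=
  sum_pos (fun k _ => mul_pos (ha i k)
    (Real.rpow_pos_of_pos (div_pos (hb i k) (price_pos hb i k)) _)) ⟨j, mem_univ j⟩

/-- A summand of the potential at `x`, expressed through the Proportional Response update
`b'` of `b`. -/
theorem potential_term_eq {x px e a b p ρ Z b' : ℝ} (hx : 0 ≤ x) (hpx : x ≤ px) (he : 0 < e)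
    (ha : 0 < a) (hb : 0 < b) (hp : 0 < p) (hρ : 0 < ρ) (hZ : 0 < Z)
    (hb' : b' = e * (a * (b / p) ^ ρ) / Z) :
    -(1 / ρ * (x * Real.log (a * x ^ (ρ - 1) / px ^ ρ))) =
      1 / ρ * (Real.log e - Real.log Z) * x + 1 / ρ * (x * Real.log (x / b'))
        - x * Real.log (x / b) + x * Real.log (px / p) := by
  rcases hx.eq_or_lt with rfl | hx
  · simp
  have hpx : 0 < px := hx.trans_le hpx
  have hbp : 0 < (b / p) ^ ρ := Real.rpow_pos_of_pos (div_pos hb hp) _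
  have hb'pos : 0 < b' := by rw [hb']; positivity
  have hlog : Real.log b' =
      Real.log e + (Real.log a + ρ * (Real.log b - Real.log p)) - Real.log Z := by
    rw [hb', Real.log_div (by positivity) hZ.ne', Real.log_mul he.ne' (by positivity),
      Real.log_mul ha.ne' hbp.ne', Real.log_rpow (div_pos hb hp), Real.log_div hb.ne' hp.ne']
  have hxr : 0 < x ^ (ρ - 1) := Real.rpow_pos_of_pos hx _
  have hpr : 0 < px ^ ρ := Real.rpow_pos_of_pos hpx _
  rw [Real.log_div (by positivity) hpr.ne', Real.log_mul ha.ne' hxr.ne', Real.log_rpow hx,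
    Real.log_rpow hpx, Real.log_div hx.ne' hb'pos.ne', Real.log_div hx.ne' hb.ne',
    Real.log_div hpx.ne' hp.ne', hlog]
  field_simp
  ring

/-- The potential at `x`, expressed through the Proportional Response update `b'` of `b`. -/
theorem PhiCD_eq {m n : ℕ} {P : Finset (Fin m)} {e : Fin m → ℝ} (he : ∀ i, 0 < e i)
    {a : Fin m → Fin n → ℝ} (ha : ∀ i j, 0 < a i j) {ρ : Fin m → ℝ} (hρ : ∀ i ∈ P, 0 < ρ i)
    {b b' x : Fin m → Fin n → ℝ} (hb : ∀ i j, 0 < b i j)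
    (hb' : ∀ i ∈ P, ∀ j, b' i j =
      e i * (a i j * (b i j / price b j) ^ ρ i) / responseNorm a ρ b i)
    (hx : Feasible e x) :
    PhiCD P a ρ x =
      ∑ i ∈ P, 1 / ρ i * (Real.log (e i) - Real.log (responseNorm a ρ b i)) * e i
        + ∑ i ∈ P, 1 / ρ i * KL (x i) (b' i) - ∑ i ∈ P, KL (x i) (b i)
        + KL (price x) (price b) + ∑ i ∈ Pᶜ, ∑ j, x i j * Real.log (price b j) := by
  have hx0 : ∀ i j, 0 ≤ x i j := fun i => (hx i).1
  have hpos : ∀ i ∈ P, -(1 / ρ i *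
      ∑ j, x i j * Real.log (a i j * x i j ^ (ρ i - 1) / price x j ^ ρ i)) =
      1 / ρ i * (Real.log (e i) - Real.log (responseNorm a ρ b i)) * e i
        + 1 / ρ i * KL (x i) (b' i) - KL (x i) (b i)
        + ∑ j, x i j * Real.log (price x j / price b j) := by
    intro i hi
    have hbudget : 1 / ρ i * (Real.log (e i) - Real.log (responseNorm a ρ b i)) * e i =
        ∑ j, 1 / ρ i * (Real.log (e i) - Real.log (responseNorm a ρ b i)) * x i j := by
      rw [← mul_sum, (hx i).2]
    rw [hbudget]
    unfold KL
    rw [mul_sum, mul_sum, ← sum_neg_distrib, ← sum_add_distrib, ← sum_sub_distrib, ← sum_add_distrib]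
    exact sum_congr rfl fun j _ => potential_term_eq (hx0 i j) (le_price hx0 i j) (he i)
      (ha i j) (hb i j) (price_pos hb i j) (hρ i hi) (responseNorm_pos ha ρ hb i j) (hb' i hi j)
  have hzero : ∀ i ∈ Pᶜ, ∑ j, x i j * Real.log (price x j) =
      ∑ j, x i j * Real.log (price x j / price b j) + ∑ j, x i j * Real.log (price b j) := by
    intro i _
    rw [← sum_add_distrib]
    refine sum_congr rfl fun j _ => ?_
    rcases (hx0 i j).eq_or_lt with h | h
    · simp [← h]
    · rw [Real.log_div (h.trans_le (le_price hx0 i j)).ne' (price_pos hb i j).ne']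
      ring
  have hprice : KL (price x) (price b) =
      ∑ i ∈ P, ∑ j, x i j * Real.log (price x j / price b j)
        + ∑ i ∈ Pᶜ, ∑ j, x i j * Real.log (price x j / price b j) := by
    rw [sum_add_sum_compl, sum_comm]
    exact sum_congr rfl fun j _ => by rw [← sum_mul]; rfl
  unfold PhiCD
  rw [← sum_neg_distrib, sum_congr rfl hpos, sum_congr rfl hzero, hprice]
  simp only [sum_add_distrib, sum_sub_distrib]
  ring

/-- Progress of one Proportional Response step from `b` to `b'`, measured against any
feasible spending `c` in which the Cobb-Douglas buyers spend as in `b'`. -/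
theorem proportional_response_step {m n : ℕ} {P : Finset (Fin m)} {e : Fin m → ℝ}
    (he : ∀ i, 0 < e i) {a : Fin m → Fin n → ℝ} (ha : ∀ i j, 0 < a i j) {ρ : Fin m → ℝ}
    (hρ : ∀ i ∈ P, 0 < ρ i) (hρ1 : ∀ i ∈ P, ρ i ≤ 1) {b b' c : Fin m → Fin n → ℝ}
    (hb : ∀ i j, 0 < b i j) (hbF : Feasible e b) (hbF' : Feasible e b')
    (hb' : ∀ i ∈ P, ∀ j, b' i j =
      e i * (a i j * (b i j / price b j) ^ ρ i) / responseNorm a ρ b i)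
    (hc : Feasible e c) (hcb : ∀ i ∉ P, c i = b' i) :
    PhiCD P a ρ b' - PhiCD P a ρ c ≤
      ∑ i ∈ P, 1 / ρ i * KL (c i) (b i) - ∑ i ∈ P, 1 / ρ i * KL (c i) (b' i)
        + ∑ i ∈ Pᶜ, KL (c i) (b i) := by
  rw [PhiCD_eq he ha hρ hb hb' hbF', PhiCD_eq he ha hρ hb hb' hc]
  have hself : ∑ i ∈ P, 1 / ρ i * KL (b' i) (b' i) = 0 :=
    sum_eq_zero fun i _ => by rw [KL_self, mul_zero]
  have hlin : ∑ i ∈ Pᶜ, ∑ j, b' i j * Real.log (price b j) =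
      ∑ i ∈ Pᶜ, ∑ j, c i j * Real.log (price b j) :=
    sum_congr rfl fun i hi => by rw [hcb i (mem_compl.1 hi)]
  have hagg := KL_price_le (fun i => (hbF' i).1) hb
  rw [← sum_add_sum_compl P] at hagg
  have hKLc : ∑ i ∈ Pᶜ, KL (b' i) (b i) = ∑ i ∈ Pᶜ, KL (c i) (b i) :=
    sum_congr rfl fun i hi => by rw [hcb i (mem_compl.1 hi)]
  have hprice : 0 ≤ KL (price c) (price b) := by
    rcases isEmpty_or_nonempty (Fin m) with h | ⟨⟨i⟩⟩
    · refine (sum_eq_zero fun j _ => ?_).ge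
      simp [price]
    · exact KL_nonneg (price_nonneg fun i => (hc i).1) (price_pos hb i)
        ((sum_price hc).trans (sum_price hbF).symm)
  have hscale : ∑ i ∈ P, KL (c i) (b i) ≤ ∑ i ∈ P, 1 / ρ i * KL (c i) (b i) :=
    sum_le_sum fun i hi => le_mul_of_one_le_left
      (KL_nonneg (hc i).1 (hb i) ((hc i).2.trans (hbF i).2.symm))
      ((one_le_div (hρ i hi)).2 (hρ1 i hi))
  linarith

/-- `O(1/T)` convergence of Proportional Response with CES
substitutes buyers (`P`, `0 < ρ_i ≤ 1`) and Cobb-Douglas buyers (`ρ_i = 0`), the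
latter jumping directly to their equilibrium spending `b*_ij = e_i a_ij`. -/
theorem proportional_response_with_cobb_douglas_sublinear {m n : ℕ}
    (P : Finset (Fin m))
    (e : Fin m → ℝ) (he : ∀ i, 0 < e i)
    (a : Fin m → Fin n → ℝ) (ha : ∀ i j, 0 < a i j)
    (ρ : Fin m → ℝ) (hρ : ∀ i, 0 ≤ ρ i ∧ ρ i ≤ 1)
    (hP : ∀ i, i ∈ P ↔ 0 < ρ i)
    (hCD : ∀ i ∉ P, ∑ j, a i j = 1)
    (b : ℕ → Fin m → Fin n → ℝ)
    (hb0pos : ∀ i j, 0 < b 0 i j) (hb0 : Feasible e (b 0))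
    -- the update rules
    (hupdPos : ∀ t, ∀ i ∈ P, ∀ j, b (t + 1) i j =
      e i * (a i j * (b t i j / price (b t) j) ^ ρ i) /
        ∑ k, a i k * (b t i k / price (b t) k) ^ ρ i)
    (hupdCD : ∀ t, ∀ i ∉ P, ∀ j, b (t + 1) i j = e i * a i j)
    -- b* : Cobb-Douglas buyers at equilibrium, and b*_{>0} minimizes Φ(·, b*_{=0})
    (bstar : Fin m → Fin n → ℝ) (hbstarFeas : Feasible e bstar)
    (hbstarCD : ∀ i ∉ P, ∀ j, bstar i j = e i * a i j)
    (hbstarMin : ∀ b', Feasible e b' →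
      PhiCD P a ρ bstar ≤ PhiCD P a ρ (mix P b' bstar))
    (T : ℕ) (hT : 1 ≤ T) :
    PhiCD P a ρ (mix P (b T) bstar) - PhiCD P a ρ bstar ≤
      (1 / (T : ℝ)) *
        ((∑ i ∈ P, (1 / ρ i) * KL (bstar i) (b 0 i)) +
          ∑ i ∈ Pᶜ, KL (bstar i) (b 0 i)) := by
  have hρP : ∀ i ∈ P, 0 < ρ i := fun i hi => (hP i).1 hi
  have hupd : ∀ t, ∀ i ∈ P, ∀ j, b (t + 1) i j =
      e i * (a i j * (b t i j / price (b t) j) ^ ρ i) / responseNorm a ρ (b t) i := hupdPos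
  have hpos : ∀ t i j, 0 < b t i j := by
    intro t
    induction t with
    | zero => exact hb0pos
    | succ t ih =>
      intro i j
      by_cases hi : i ∈ P
      · rw [hupd t i hi j]
        exact div_pos (mul_pos (he i) (mul_pos (ha i j)
          (Real.rpow_pos_of_pos (div_pos (ih i j) (price_pos ih i j)) _)))
          (responseNorm_pos ha ρ ih i j)
      · rw [hupdCD t i hi j]
        exact mul_pos (he i) (ha i j)
  have hfeas : ∀ t, Feasible e (b t) := by
    intro t
    cases t with
    | zero => exact hb0
    | succ t =>
      refine fun i => ⟨fun j => (hpos _ i j).le, ?_⟩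
      by_cases hi : i ∈ P
      · have hn : Nonempty (Fin n) := by
          by_contra h
          rw [not_nonempty_iff] at h
          have := (hb0 i).2
          simp only [univ_eq_empty, sum_empty] at this
          exact (he i).ne this
        obtain ⟨k⟩ := hn
        simp only [hupd t i hi]
        rw [← sum_div, ← mul_sum]
        exact mul_div_cancel_right₀ _ (responseNorm_pos ha ρ (hpos t) i k).ne'
      · simp only [hupdCD t i hi]
        rw [← mul_sum, hCD i hi, mul_one]
  have hCDeq : ∀ t, ∀ i ∉ P, bstar i = b (t + 1) i := fun t i hi =>
    funext fun j => by rw [hbstarCD i hi j, hupdCD t i hi j]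
  have hstep : ∀ t, PhiCD P a ρ (b (t + 1)) - PhiCD P a ρ bstar ≤
      ∑ i ∈ P, 1 / ρ i * KL (bstar i) (b t i) - ∑ i ∈ P, 1 / ρ i * KL (bstar i) (b (t + 1) i)
        + ∑ i ∈ Pᶜ, KL (bstar i) (b t i) := fun t =>
    proportional_response_step he ha hρP (fun i _ => (hρ i).2) (hpos t) (hfeas t)
      (hfeas (t + 1)) (hupd t) hbstarFeas (hCDeq t)
  have hKL : ∀ t, ∀ c, Feasible e c → 0 ≤ ∑ i ∈ P, 1 / ρ i * KL (c i) (b t i) :=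
    fun t c hc => sum_nonneg fun i hi => mul_nonneg (one_div_pos.2 (hρP i hi)).le
      (KL_nonneg (hc i).1 (hpos t i) ((hc i).2.trans (hfeas t i).2.symm))
  have hmono : ∀ t, PhiCD P a ρ (b (t + 2)) ≤ PhiCD P a ρ (b (t + 1)) := by
    intro t
    have h := proportional_response_step he ha hρP (fun i _ => (hρ i).2) (hpos (t + 1))
      (hfeas (t + 1)) (hfeas (t + 2)) (hupd (t + 1)) (hfeas (t + 1))
      (fun i hi => by rw [← hCDeq t i hi, ← hCDeq (t + 1) i hi])
    simp only [KL_self, mul_zero, sum_const_zero] at h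
    linarith [hKL (t + 2) _ (hfeas (t + 1))]
  have htel : ∀ t : ℕ, ((t : ℝ) + 1) * (PhiCD P a ρ (b (t + 1)) - PhiCD P a ρ bstar) ≤
      ∑ i ∈ P, 1 / ρ i * KL (bstar i) (b 0 i)
        - ∑ i ∈ P, 1 / ρ i * KL (bstar i) (b (t + 1) i)
        + ∑ i ∈ Pᶜ, KL (bstar i) (b 0 i) := by
    intro t
    induction t with
    | zero => simpa using hstep 0
    | succ t ih =>
      have hs := hstep (t + 1)
      have hz : ∑ i ∈ Pᶜ, KL (bstar i) (b (t + 1) i) = 0 :=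
        sum_eq_zero fun i hi => by rw [hCDeq t i (mem_compl.1 hi), KL_self]
      have hm := mul_le_mul_of_nonneg_left (hmono t) (by positivity : (0 : ℝ) ≤ (t : ℝ) + 1)
      push_cast
      linarith
  obtain ⟨t, rfl⟩ := Nat.exists_eq_add_of_le' hT
  have hmix : mix P (b (t + 1)) bstar = b (t + 1) := by
    funext i
    by_cases hi : i ∈ P
    · simp [mix, hi]
    · simp [mix, hi, hCDeq t i hi]
  rw [hmix, one_div_mul_eq_div, le_div_iff₀ (by positivity), mul_comm]
  push_cast
  linarith [htel t, hKL (t + 1) _ hbstarFeas]
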